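/- Let V, H be real Hilbert spaces, J a symplectic operator on V, K closed densely defined from V to H with KJKᵀ skew-adjoint. Any two finite-energy weak solutions of ∂_t u = JKᵀKu with the same initial value u(0) = u₀ ∈ D(K) coincide: if u(t) ∈ D(K) for all t, u(0)=0, and d/dt ⟨v, Ju(t)⟩ = -⟨Kv, Ku(t)⟩ for all v ∈ D(K), then u(t) = 0 for all t. -/

import Mathlib

open ContinuousLinearMap
open scoped RealInnerProductSpace

/-- one-dimensional gluing: a locally `C`-Lipschitz function on `[0,h]`. -/
lemma wsu_glue (φ : ℝ → ℝ) (C h : ℝ) (hh : 0 ≤ h)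
    (hloc : ∀ s, 0 ≤ s → s ≤ h → ∃ ρ > 0, ∀ a b, |a - s| < ρ → |b - s| < ρ → a ≤ b →
      |φ b - φ a| ≤ C * (b - a)) : |φ h - φ 0| ≤ C * h := by
  set S : Set ℝ := {s | 0 ≤ s ∧ s ≤ h ∧ |φ s - φ 0| ≤ C * s} with hS
  have h0S : (0 : ℝ) ∈ S := ⟨le_rfl, hh, by simp⟩
  have hbdd : BddAbove S := ⟨h, fun s hs => hs.2.1⟩
  have hσ0 : 0 ≤ sSup S := le_csSup hbdd h0S
  have hσh : sSup S ≤ h := csSup_le ⟨0, h0S⟩ fun s hs => hs.2.1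
  obtain ⟨ρ, hρ, hl⟩ := hloc _ hσ0 hσh
  obtain ⟨s, hs, hsσ⟩ := exists_lt_of_lt_csSup ⟨0, h0S⟩ (show sSup S - ρ < sSup S by linarith)
  have hsle : s ≤ sSup S := le_csSup hbdd hs
  have key : ∀ b, s ≤ b → b ≤ h → b < sSup S + ρ → b ∈ S := by
    intro b hsb hbh hb
    have := hl s b (by rw [abs_lt]; constructor <;> linarith)
      (by rw [abs_lt]; constructor <;> linarith) hsb
    refine ⟨hs.1.trans hsb, hbh, ?_⟩
    have h3 := hs.2.2
    rw [abs_le] at *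
    constructor <;> linarith [this.1, this.2, h3.1, h3.2]
  by_cases hc : h < sSup S + ρ
  · exact (key h (hsle.trans hσh) le_rfl hc).2.2
  · have := le_csSup hbdd (key (sSup S + ρ / 2) (by linarith) (by linarith) (by linarith))
    linarith

/-- forward step from a bad point. -/
lemma wsu_forward (f : ℝ → ℝ → ℝ) (U : ℝ → ℝ → Prop) (x0 y0 ρ α ε : ℝ) (hε : 0 < ε)
    (hcx : ∀ y, Continuous fun x => f x y) (hcy : ∀ x, Continuous fun y => f x y)
    (hE : ∀ x y, ¬ U x y → |x - x0| < ρ → |y - y0| < ρ → ∀ h, |h| < 2 * ρ →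
      |f (x + h) y - f x y - α * h| ≤ ε * |h| ∧ |f x (y + h) - f x y + α * h| ≤ ε * |h|)
    (hseg : ∀ x y h, 0 ≤ h → (∀ s, 0 ≤ s → s ≤ h → U (x + s) (y + s)) →
      |f (x + h) (y + h) - f x y| ≤ 2 * ε * h)
    (x y h : ℝ) (hU : ¬ U x y) (hh : 0 < h) (hx : |x - x0| < ρ) (hy : |y - y0| < ρ)
    (hxh : |x + h - x0| < ρ) (hyh : |y + h - y0| < ρ)
    (hs : ∀ s, 0 < s → s ≤ h → U (x + s) (y + s)) :
    |f (x + h) (y + h) - f x y| ≤ 2 * ε * h := by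
  rw [abs_lt] at hx hy hxh hyh
  by_cases hit : ∃ δ τ, 0 < δ ∧ 0 ≤ τ ∧ δ + τ ≤ h ∧ ¬ U (x + δ + τ) (y + τ)
  · obtain ⟨δ, τ, hδ, hτ, hle, hP⟩ := hit
    -- from (x,y) horizontally to (x+δ+τ, y)
    have e1 := (hE x y hU (abs_lt.2 hx) (abs_lt.2 hy) (δ + τ)
      (by rw [abs_lt]; constructor <;> linarith)).1
    have hbx : |x + δ + τ - x0| < ρ := by rw [abs_lt]; constructor <;> linarith
    have hby : |y + τ - y0| < ρ := by rw [abs_lt]; constructor <;> linarith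
    have e2 := (hE _ _ hP hbx hby (-τ) (by rw [abs_lt]; constructor <;> linarith)).2
    have e3 := (hE _ _ hP hbx hby δ (by rw [abs_lt]; constructor <;> linarith)).2
    have e4 := hseg (x + δ + τ) (y + τ + δ) (h - δ - τ) (by linarith) (by
      intro s hs0 hs1
      have := hs (δ + τ + s) (by linarith) (by linarith)
      convert this using 1 <;> ring)
    rw [show x + δ + τ + (h - δ - τ) = x + h by ring,
      show y + τ + δ + (h - δ - τ) = y + h by ring] at e4
    rw [show y + τ + -τ = y by ring, abs_neg, abs_of_nonneg hτ] at e2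
    rw [abs_of_pos hδ] at e3
    rw [abs_of_nonneg (by linarith : 0 ≤ δ + τ), show x + (δ + τ) = x + δ + τ by ring] at e1
    rw [abs_le] at *
    constructor <;> nlinarith [e1.1, e1.2, e2.1, e2.2, e3.1, e3.2, e4.1, e4.2]
  · push Not at hit
    have hb : ∀ δ, 0 < δ → δ < h → |f (x + h) (y + (h - δ)) - f (x + δ) y| ≤ 2 * ε * h := by
      intro δ hδ hδh
      have := hseg (x + δ) y (h - δ) (by linarith) (by
        intro s hs0 hs1
        exact hit δ s hδ hs0 (by linarith))
      rw [show x + δ + (h - δ) = x + h by ring] at this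
      nlinarith
    have hcont : Continuous fun δ : ℝ => |f (x + h) (y + (h - δ)) - f (x + δ) y| := by
      have h1 : Continuous fun δ : ℝ => f (x + h) (y + (h - δ)) :=
        (hcy (x + h)).comp (by fun_prop : Continuous fun δ : ℝ => y + (h - δ))
      have h2 : Continuous fun δ : ℝ => f (x + δ) y :=
        (hcx y).comp (by fun_prop : Continuous fun δ : ℝ => x + δ)
      exact (h1.sub h2).abs
    have ht : Filter.Tendsto (fun δ : ℝ => |f (x + h) (y + (h - δ)) - f (x + δ) y|)
        (nhdsWithin 0 (Set.Ioi 0)) (nhds (|f (x + h) (y + (h - 0)) - f (x + 0) y|)) :=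
      (hcont.tendsto 0).mono_left nhdsWithin_le_nhds
    have := le_of_tendsto ht (b := 2 * ε * h) (by
      filter_upwards [Ioo_mem_nhdsGT hh] with δ hδ
      exact hb δ hδ.1 hδ.2)
    simpa using this

/-- backward step to a bad point, by reflection. -/
lemma wsu_backward (f : ℝ → ℝ → ℝ) (U : ℝ → ℝ → Prop) (x0 y0 ρ α ε : ℝ) (hε : 0 < ε)
    (hcx : ∀ y, Continuous fun x => f x y) (hcy : ∀ x, Continuous fun y => f x y)
    (hE : ∀ x y, ¬ U x y → |x - x0| < ρ → |y - y0| < ρ → ∀ h, |h| < 2 * ρ →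
      |f (x + h) y - f x y - α * h| ≤ ε * |h| ∧ |f x (y + h) - f x y + α * h| ≤ ε * |h|)
    (hseg : ∀ x y h, 0 ≤ h → (∀ s, 0 ≤ s → s ≤ h → U (x + s) (y + s)) →
      |f (x + h) (y + h) - f x y| ≤ 2 * ε * h)
    (x y h : ℝ) (hU : ¬ U (x + h) (y + h)) (hh : 0 < h) (hx : |x - x0| < ρ) (hy : |y - y0| < ρ)
    (hxh : |x + h - x0| < ρ) (hyh : |y + h - y0| < ρ)
    (hs : ∀ s, 0 ≤ s → s < h → U (x + s) (y + s)) :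
    |f (x + h) (y + h) - f x y| ≤ 2 * ε * h := by
  have hneg : ∀ a b : ℝ, |a - -b| = |-a - b| := fun a b => by
    rw [← abs_neg]; congr 1; ring
  have := wsu_forward (fun a b => f (-a) (-b)) (fun a b => U (-a) (-b)) (-x0) (-y0) ρ (-α) ε hε
    (fun y => (hcx (-y)).comp continuous_neg) (fun x => (hcy (-x)).comp continuous_neg)
    (by
      intro a b hab ha hb k hk
      have := hE (-a) (-b) hab (by rwa [← hneg]) (by rwa [← hneg]) (-k) (by rwa [abs_neg])
      rw [abs_neg] at this
      simp only [neg_add]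
      convert this using 3 <;> ring_nf)
    (by
      intro a b k hk hab
      have := hseg (-(a + k)) (-(b + k)) k hk (by
        intro s h0 h1
        have := hab (k - s) (by linarith) (by linarith)
        convert this using 1 <;> ring)
      rw [show -(a + k) + k = -a by ring, show -(b + k) + k = -b by ring] at this
      rwa [abs_sub_comm])
    (-(x + h)) (-(y + h)) h (by simpa using hU) hh
    (by rw [hneg]; simpa using hxh) (by rw [hneg]; simpa using hyh)
    (by rw [hneg]; convert hx using 2; ring) (by rw [hneg]; convert hy using 2; ring)
    (by
      intro s h0 h1
      have := hs (h - s) (by linarith) (by linarith)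
      convert this using 1 <;> ring)
  rw [abs_sub_comm]
  convert this using 2
  simp only [neg_neg]
  congr 2 <;> ring

/-- in a box where all bad points are uniformly controlled, `f` is Lipschitz on diagonals. -/
lemma wsu_box (f : ℝ → ℝ → ℝ) (U : ℝ → ℝ → Prop) (hUo : IsOpen {p : ℝ × ℝ | U p.1 p.2})
    (x0 y0 ρ α ε : ℝ) (hε : 0 < ε)
    (hcx : ∀ y, Continuous fun x => f x y) (hcy : ∀ x, Continuous fun y => f x y)
    (hE : ∀ x y, ¬ U x y → |x - x0| < ρ → |y - y0| < ρ → ∀ h, |h| < 2 * ρ →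
      |f (x + h) y - f x y - α * h| ≤ ε * |h| ∧ |f x (y + h) - f x y + α * h| ≤ ε * |h|)
    (hseg : ∀ x y h, 0 ≤ h → (∀ s, 0 ≤ s → s ≤ h → U (x + s) (y + s)) →
      |f (x + h) (y + h) - f x y| ≤ 2 * ε * h)
    (x y h : ℝ) (hh : 0 ≤ h) (hx : |x - x0| < ρ) (hy : |y - y0| < ρ)
    (hxh : |x + h - x0| < ρ) (hyh : |y + h - y0| < ρ) :
    |f (x + h) (y + h) - f x y| ≤ 2 * ε * h := by
  set S : Set ℝ := Set.Icc 0 h ∩ {s | ¬ U (x + s) (y + s)} with hS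
  have hSc : IsCompact S := by
    refine isCompact_Icc.inter_right ?_
    have : IsClosed ((fun s : ℝ => (x + s, y + s)) ⁻¹' {p : ℝ × ℝ | U p.1 p.2}ᶜ) :=
      hUo.isClosed_compl.preimage (by fun_prop)
    exact this
  rcases S.eq_empty_or_nonempty with he | hne
  · refine hseg x y h hh fun s h0 h1 => ?_
    by_contra hc
    have : s ∈ S := ⟨⟨h0, h1⟩, hc⟩
    rw [he] at this
    exact this
  obtain ⟨a, haS, ha⟩ := hSc.exists_isLeast hne
  obtain ⟨b, hbS, hb⟩ := hSc.exists_isGreatest hne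
  have hab : a ≤ b := ha hbS
  obtain ⟨⟨ha0, hah⟩, haU⟩ := haS
  obtain ⟨⟨hb0, hbh⟩, hbU⟩ := hbS
  simp only [Set.mem_setOf_eq] at haU hbU
  have hbx : ∀ s, 0 ≤ s → s ≤ h → |x + s - x0| < ρ := by
    intro s h0 h1; rw [abs_lt] at *; constructor <;> linarith
  have hby : ∀ s, 0 ≤ s → s ≤ h → |y + s - y0| < ρ := by
    intro s h0 h1; rw [abs_lt] at *; constructor <;> linarith
  have e1 : |f (x + a) (y + a) - f x y| ≤ 2 * ε * a := by
    rcases ha0.eq_or_lt with h0 | h0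
    · simp [← h0]
    · refine wsu_backward f U x0 y0 ρ α ε hε hcx hcy hE hseg x y a haU h0 hx hy
        (hbx a ha0 hah) (hby a ha0 hah) fun s h1 h2 => ?_
      by_contra hc
      have : a ≤ s := ha ⟨⟨h1, by linarith⟩, hc⟩
      linarith
  have e2 : |f (x + h) (y + h) - f (x + b) (y + b)| ≤ 2 * ε * (h - b) := by
    rcases hbh.eq_or_lt with h0 | h0
    · simp [← h0]
    · have := wsu_forward f U x0 y0 ρ α ε hε hcx hcy hE hseg (x + b) (y + b) (h - b) hbU
        (by linarith) (hbx b hb0 hbh) (hby b hb0 hbh) (by convert hxh using 2; ring)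
        (by convert hyh using 2; ring) (by
          intro s h1 h2
          by_contra hc
          have : b + s ≤ b := hb ⟨⟨by linarith, by linarith⟩, by
            simpa only [Set.mem_setOf_eq, add_assoc] using hc⟩
          linarith)
      rwa [show x + b + (h - b) = x + h by ring, show y + b + (h - b) = y + h by ring] at this
  have hd : |b - a| < 2 * ρ := by
    rw [abs_lt] at *; constructor <;> linarith
  have e3 := (hE _ _ haU (hbx a ha0 hah) (hby a ha0 hah) (b - a) hd).1
  have e4 := (hE _ _ hbU (hbx b hb0 hbh) (hby b hb0 hbh) (a - b) (by rwa [abs_sub_comm])).2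
  rw [abs_sub_comm a b] at e4
  rw [abs_of_nonneg (by linarith : 0 ≤ b - a)] at e3 e4
  rw [show x + a + (b - a) = x + b by ring] at e3
  rw [show y + b + (a - b) = y + a by ring] at e4
  rw [abs_le] at e1 e2 e3 e4 ⊢
  constructor <;> nlinarith [e1.1, e1.2, e2.1, e2.2, e3.1, e3.2, e4.1, e4.2]

/-- closedness of the uniformity sets, for a separately continuous function. -/
lemma wsu_closed (f : ℝ → ℝ → ℝ) (α ε r : ℝ) (hr : 0 < r)
    (hcx : ∀ y, Continuous fun x => f x y) (hcy : ∀ x, Continuous fun y => f x y) :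
    IsClosed {p : ℝ × ℝ | ∀ h, |h| < r →
      |f (p.1 + h) p.2 - f p.1 p.2 - α * h| ≤ ε * |h| ∧
      |f p.1 (p.2 + h) - f p.1 p.2 + α * h| ≤ ε * |h|} := by
  refine IsSeqClosed.isClosed ?_
  intro p q hp hpq
  have hp1 : Filter.Tendsto (fun k => (p k).1) Filter.atTop (nhds q.1) :=
    (continuous_fst.tendsto q).comp hpq
  have hp2 : Filter.Tendsto (fun k => (p k).2) Filter.atTop (nhds q.2) :=
    (continuous_snd.tendsto q).comp hpq
  have hk1 : ∀ h, Filter.Tendsto (fun k => h + q.1 - (p k).1) Filter.atTop (nhds h) := by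
    intro h
    simpa using hp1.const_sub (h + q.1)
  have hk2 : ∀ h, Filter.Tendsto (fun k => h + q.2 - (p k).2) Filter.atTop (nhds h) := by
    intro h
    simpa using hp2.const_sub (h + q.2)
  have ev1 : ∀ h, |h| < r → ∀ᶠ k in Filter.atTop, |h + q.1 - (p k).1| < r := fun h hh =>
    (hk1 h).abs.eventually_lt_const hh
  have ev2 : ∀ h, |h| < r → ∀ᶠ k in Filter.atTop, |h + q.2 - (p k).2| < r := fun h hh =>
    (hk2 h).abs.eventually_lt_const hh
  have hf : Filter.Tendsto (fun k => f (p k).1 (p k).2) Filter.atTop (nhds (f q.1 q.2)) := by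
    have t1 : Filter.Tendsto (fun k => f (p k).1 q.2) Filter.atTop (nhds (f q.1 q.2)) :=
      ((hcx q.2).tendsto q.1).comp hp1
    have t2 : Filter.Tendsto (fun k => f (p k).1 q.2 - f (p k).1 (p k).2
        + α * (0 + q.2 - (p k).2)) Filter.atTop (nhds 0) := by
      refine squeeze_zero_norm' (a := fun k => ε * |0 + q.2 - (p k).2|) ?_ ?_
      · filter_upwards [ev2 0 (by simpa using hr)] with k hk
        have := (hp k _ hk).2
        rwa [show (p k).2 + (0 + q.2 - (p k).2) = q.2 by ring] at this
      · simpa using (hk2 0).abs.const_mul ε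
    have t3 := (t1.sub t2).add ((hk2 0).const_mul α)
    simp only [sub_zero, mul_zero, add_zero] at t3
    refine t3.congr fun k => ?_
    ring
  intro h hh
  constructor
  · have t1 : Filter.Tendsto (fun k => f (q.1 + h) (p k).2) Filter.atTop
        (nhds (f (q.1 + h) q.2)) := ((hcy (q.1 + h)).tendsto q.2).comp hp2
    refine le_of_tendsto_of_tendsto ((t1.sub hf).sub ((hk1 h).const_mul α)).abs
      ((hk1 h).abs.const_mul ε) ?_
    filter_upwards [ev1 h hh] with k hk
    have := (hp k _ hk).1
    rwa [show (p k).1 + (h + q.1 - (p k).1) = q.1 + h by ring] at this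
  · have t1 : Filter.Tendsto (fun k => f (p k).1 (q.2 + h)) Filter.atTop
        (nhds (f q.1 (q.2 + h))) := ((hcx (q.2 + h)).tendsto q.1).comp hp1
    refine le_of_tendsto_of_tendsto ((t1.sub hf).add ((hk2 h).const_mul α)).abs
      ((hk2 h).abs.const_mul ε) ?_
    filter_upwards [ev2 h hh] with k hk
    have := (hp k _ hk).2
    rwa [show (p k).2 + (h + q.2 - (p k).2) = q.2 + h by ring] at this

lemma wsu_deriv_bound (g : ℝ → ℝ) (g' x α ε : ℝ) (hε : 0 < ε) (hg : HasDerivAt g g' x)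
    (hα : |g' - α| ≤ ε / 2) :
    ∃ r > 0, ∀ h, |h| < r → |g (x + h) - g x - α * h| ≤ ε * |h| := by
  have h1 := (hasDerivAt_iff_isLittleO_nhds_zero.1 hg).def (half_pos hε)
  obtain ⟨r, hr, hb⟩ := Metric.eventually_nhds_iff.1 h1
  refine ⟨r, hr, fun h hh => ?_⟩
  have h2 := hb (y := h) (by simpa [Real.dist_eq] using hh)
  simp only [Real.norm_eq_abs, smul_eq_mul] at h2
  calc |g (x + h) - g x - α * h| = |(g (x + h) - g x - h * g') + (g' - α) * h| := by
        congr 1; ring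
    _ ≤ |g (x + h) - g x - h * g'| + |(g' - α) * h| := abs_add_le _ _
    _ ≤ ε / 2 * |h| + ε / 2 * |h| := by
        rw [abs_mul]; gcongr
    _ = ε * |h| := by ring

/-- separately differentiable solutions of `f_x + f_y = 0` are constant on diagonals. -/
lemma wsu_transport (f a : ℝ → ℝ → ℝ)
    (hdx : ∀ x y, HasDerivAt (fun s => f s y) (a x y) x)
    (hdy : ∀ x y, HasDerivAt (fun t => f x t) (-(a x y)) y) (x y h : ℝ) (hh : 0 ≤ h) :
    f (x + h) (y + h) = f x y := by
  have hcx : ∀ y, Continuous fun x => f x y := fun y =>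
    continuous_iff_continuousAt.2 fun x => (hdx x y).continuousAt
  have hcy : ∀ x, Continuous fun y => f x y := fun x =>
    continuous_iff_continuousAt.2 fun y => (hdy x y).continuousAt
  have main : ∀ ε > 0, |f (x + h) (y + h) - f x y| ≤ 2 * ε * h := by
    intro ε hε
    let U : ℝ → ℝ → Prop := fun x0 y0 => ∃ ρ > 0, ∀ x y h, 0 ≤ h → |x - x0| < ρ →
      |y - y0| < ρ → |x + h - x0| < ρ → |y + h - y0| < ρ →
      |f (x + h) (y + h) - f x y| ≤ 2 * ε * h
    have hUo : IsOpen {p : ℝ × ℝ | U p.1 p.2} := by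
      rw [Metric.isOpen_iff]
      rintro ⟨x0, y0⟩ ⟨ρ, hρ, hb⟩
      refine ⟨ρ / 2, half_pos hρ, ?_⟩
      rintro ⟨x1, y1⟩ h1
      rw [Metric.mem_ball, Prod.dist_eq, max_lt_iff, Real.dist_eq, Real.dist_eq] at h1
      obtain ⟨hx1, hy1⟩ := h1
      simp only at hx1 hy1
      refine ⟨ρ / 2, half_pos hρ, fun x y h hh e1 e2 e3 e4 => hb x y h hh ?_ ?_ ?_ ?_⟩ <;>
      · rw [abs_lt] at *
        constructor <;> simp only <;> linarith
    have hseg : ∀ x y h, 0 ≤ h → (∀ s, 0 ≤ s → s ≤ h → U (x + s) (y + s)) →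
        |f (x + h) (y + h) - f x y| ≤ 2 * ε * h := by
      intro x y h hh hs
      have := wsu_glue (fun s => f (x + s) (y + s)) (2 * ε) h hh (by
        intro s h0 h1
        obtain ⟨ρ, hρ, hb⟩ := hs s h0 h1
        refine ⟨ρ, hρ, fun c d hc hd hcd => ?_⟩
        have := hb (x + c) (y + c) (d - c) (by linarith) (by convert hc using 2; ring)
          (by convert hc using 2; ring) (by convert hd using 2; ring)
          (by convert hd using 2; ring)
        rwa [show x + c + (d - c) = x + d by ring, show y + c + (d - c) = y + d by ring] at this)
      simpa using this
    refine hseg x y h hh fun s _ _ => ?_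
    by_contra hbad
    let P : Set (ℝ × ℝ) := {p : ℝ × ℝ | U p.1 p.2}ᶜ
    have hPc : IsClosed P := hUo.isClosed_compl
    haveI : CompleteSpace P := hPc.completeSpace_coe
    haveI : Nonempty P := ⟨⟨(x + s, y + s), hbad⟩⟩
    let E : ℕ × ℤ → Set (ℝ × ℝ) := fun i => {p : ℝ × ℝ | ∀ h, |h| < 1 / ((i.1 : ℝ) + 1) →
      |f (p.1 + h) p.2 - f p.1 p.2 - (i.2 * ε) * h| ≤ ε * |h| ∧
      |f p.1 (p.2 + h) - f p.1 p.2 + (i.2 * ε) * h| ≤ ε * |h|}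
    have hEc : ∀ i, IsClosed (E i) := fun i =>
      wsu_closed f (i.2 * ε) ε (1 / ((i.1 : ℝ) + 1)) (by positivity) hcx hcy
    have hcov : ∀ p, ∃ i, p ∈ E i := by
      rintro ⟨x1, y1⟩
      have hk : |a x1 y1 - (round (a x1 y1 / ε) : ℤ) * ε| ≤ ε / 2 := by
        have := abs_sub_round (a x1 y1 / ε)
        have h2 : a x1 y1 - (round (a x1 y1 / ε) : ℤ) * ε
            = (a x1 y1 / ε - (round (a x1 y1 / ε) : ℤ)) * ε := by field_simp
        rw [h2, abs_mul, abs_of_pos hε]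
        nlinarith
      obtain ⟨r1, hr1, hb1⟩ := wsu_deriv_bound _ _ _ _ ε hε (hdx x1 y1) hk
      obtain ⟨r2, hr2, hb2⟩ := wsu_deriv_bound _ _ _ (-((round (a x1 y1 / ε) : ℤ) * ε)) ε hε
        (hdy x1 y1) (by rw [← abs_neg]; convert hk using 2; ring)
      obtain ⟨n, hn⟩ := exists_nat_one_div_lt (lt_min hr1 hr2)
      refine ⟨(n, round (a x1 y1 / ε)), fun h hh => ⟨?_, ?_⟩⟩
      · exact hb1 h (hh.trans (hn.trans_le (min_le_left _ _)))
      · have := hb2 h (hh.trans (hn.trans_le (min_le_right _ _)))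
        convert this using 2
        ring
    obtain ⟨i, hi⟩ := nonempty_interior_of_iUnion_of_closed
      (f := fun i => ((↑) : P → ℝ × ℝ) ⁻¹' E i)
      (fun i => (hEc i).preimage continuous_subtype_val)
      (Set.eq_univ_of_forall fun p => by
        obtain ⟨i, hi⟩ := hcov p
        exact Set.mem_iUnion.2 ⟨i, hi⟩)
    obtain ⟨⟨⟨x0, y0⟩, hp0⟩, hint⟩ := hi
    obtain ⟨ρ, hρ, hball⟩ := Metric.isOpen_iff.1 isOpen_interior _ hint
    have hn : (0 : ℝ) < 1 / ((i.1 : ℝ) + 1) := by positivity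
    have hρ' : 0 < min ρ (1 / ((i.1 : ℝ) + 1) / 2) := lt_min hρ (half_pos hn)
    refine hp0 ⟨min ρ (1 / ((i.1 : ℝ) + 1) / 2), hρ', fun x y h hh e1 e2 e3 e4 => ?_⟩
    refine wsu_box f U hUo x0 y0 _ (i.2 * ε) ε hε hcx hcy ?_ hseg x y h hh e1 e2 e3 e4
    intro x y hU hx hy h hh
    have hmem : (⟨(x, y), hU⟩ : P) ∈ Metric.ball (⟨(x0, y0), hp0⟩ : P) ρ := by
      rw [Metric.mem_ball, Subtype.dist_eq, Prod.dist_eq, max_lt_iff, Real.dist_eq, Real.dist_eq]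
      exact ⟨hx.trans_le (min_le_left _ _), hy.trans_le (min_le_left _ _)⟩
    have h4 := interior_subset (hball hmem)
    have h3 : (x, y) ∈ E i := h4
    refine h3 h (hh.trans_le ?_)
    have := min_le_right ρ (1 / ((i.1 : ℝ) + 1) / 2)
    linarith
  have hz : |f (x + h) (y + h) - f x y| ≤ 0 := by
    refine le_of_forall_pos_le_add fun η hη => ?_
    have h1 : 0 < η / (2 * (h + 1)) := by positivity
    have h2 := main _ h1
    have h3 : 2 * (η / (2 * (h + 1))) * h ≤ η := by
      rw [show 2 * (η / (2 * (h + 1))) * h = η * h / (h + 1) by field_simp]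
      rw [div_le_iff₀ (by linarith)]
      nlinarith
    linarith
  have := abs_nonpos_iff.1 hz
  linarith

/-- uniqueness of finite-energy weak solutions of `∂_t u = J Kᵀ K u`.
With `J` symplectic on the real Hilbert space `V` and `K` closed densely defined from `V`
to `H` (domain `D`, transpose `Kt` on `Dt`) such that `K J Kᵀ` is skew-adjoint on its
natural domain, any finite-energy weak solution with zero initial value vanishes:
if `u t ∈ D(K)` for all `t`, `u 0 = 0`, and `d/dt ⟨v, J u(t)⟩ = -⟨K v, K u(t)⟩` for all
`v ∈ D(K)`, then `u t = 0` for all `t`. -/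
theorem weak_solution_uniqueness
    {V H : Type*} [NormedAddCommGroup V] [InnerProductSpace ℝ V] [CompleteSpace V]
    [NormedAddCommGroup H] [InnerProductSpace ℝ H] [CompleteSpace H]
    (J : V →L[ℝ] V)
    (hJ1 : (ContinuousLinearMap.adjoint J).comp J = 1) (hJ2 : J.comp J = -1)
    (K : V →ₗ[ℝ] H) (D : Set V) (hD : Dense D)
    (Kt : H →ₗ[ℝ] V) (Dt : Set H)
    (hadj : ∀ v ∈ D, ∀ f ∈ Dt, ⟪K v, f⟫ = ⟪v, Kt f⟫)
    -- skew-adjointness of `K J Kᵀ` on its natural domain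
    (hskew : ∀ f ∈ {f | f ∈ Dt ∧ J (Kt f) ∈ D}, ∀ g ∈ {f | f ∈ Dt ∧ J (Kt f) ∈ D},
      ⟪K (J (Kt f)), g⟫ = -⟪f, K (J (Kt g))⟫)
    -- `u` is a finite-energy weak solution with zero initial data
    (u : ℝ → V)
    (hmem : ∀ t : ℝ, u t ∈ D)
    (h0 : u 0 = 0)
    (hweak : ∀ v ∈ D, ∀ t : ℝ,
      HasDerivAt (fun s : ℝ => ⟪v, J (u s)⟫) (-⟪K v, K (u t)⟫) t) :
    ∀ t : ℝ, u t = 0 := by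
  have hJJ : ∀ v, J (J v) = -v := fun v => by
    have := congrArg (fun T : V →L[ℝ] V => T v) hJ2
    simpa using this
  have hJi : ∀ v w, ⟪J v, J w⟫ = ⟪v, w⟫ := fun v w => by
    have := congrArg (fun T : V →L[ℝ] V => T v) hJ1
    simp only [ContinuousLinearMap.comp_apply, ContinuousLinearMap.one_apply] at this
    rw [← ContinuousLinearMap.adjoint_inner_left, this]
  have hanti : ∀ v w, ⟪v, J w⟫ = -⟪w, J v⟫ := fun v w => by
    rw [← hJi v (J w), hJJ, inner_neg_right, real_inner_comm]
  have hdx : ∀ x y, HasDerivAt (fun s => ⟪u y, J (u s)⟫) (-⟪K (u y), K (u x)⟫) x :=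
    fun x y => hweak (u y) (hmem y) x
  have hdy : ∀ x y, HasDerivAt (fun t => ⟪u t, J (u x)⟫) (-(-⟪K (u y), K (u x)⟫)) y := by
    intro x y
    have h1 := (hweak (u x) (hmem x) y).neg
    rw [real_inner_comm (K (u x)) (K (u y))]
    refine h1.congr_of_eventuallyEq (Filter.Eventually.of_forall fun t => ?_)
    exact hanti _ _
  have htr := wsu_transport (fun s t => ⟪u t, J (u s)⟫) (fun s t => -⟪K (u t), K (u s)⟫) hdx hdy
  have hF : ∀ s t, ⟪u t, J (u s)⟫ = 0 := by
    intro s t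
    rcases le_total 0 t with ht | ht
    · have := htr (s - t) 0 t ht
      simpa [h0] using this
    · have := htr s t (-t) (by linarith)
      simpa [h0] using this.symm
  have hK : ∀ t, K (u t) = 0 := by
    intro t
    have h1 := hdx t t
    simp only [hF] at h1
    have h2 := h1.unique (hasDerivAt_const t (0 : ℝ))
    exact inner_self_eq_zero.1 (neg_eq_zero.1 h2)
  intro t
  have hv : ∀ v ∈ D, ⟪v, J (u t)⟫ = 0 := by
    intro v hv
    have hd : ∀ s, HasDerivAt (fun s : ℝ => ⟪v, J (u s)⟫) 0 s := by
      intro s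
      have := hweak v hv s
      simpa [hK] using this
    have := is_const_of_deriv_eq_zero (fun s => (hd s).differentiableAt)
      (fun s => (hd s).deriv) t 0
    simpa [h0] using this
  have hall : (fun v : V => ⟪v, J (u t)⟫) = fun _ => 0 :=
    Continuous.ext_on hD (by fun_prop) continuous_const fun v hvD => hv v hvD
  have hJu : J (u t) = 0 := inner_self_eq_zero.1 (congrFun hall (J (u t)))
  have := hJJ (u t)
  rw [hJu, map_zero] at this
  exact neg_eq_zero.1 this.symm
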